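/- If sequences of probability measures μ_i ⇒ μ and ν_i ⇒ ν weakly on ℝ^d, then the IPRW distance is lower semicontinuous: PW_{p,k}(μ, ν) ≤ liminf_{i→∞} PW_{p,k}(μ_i, ν_i). -/

import Mathlib

open MeasureTheory Filter Topology
open scoped ENNReal BoundedContinuousFunction

noncomputable def Wp {α : Type*} [MeasurableSpace α] [PseudoMetricSpace α]
    (p : ℝ) (μ ν : Measure α) : ℝ≥0∞ :=
  ⨅ π ∈ {π : Measure (α × α) | π.map Prod.fst = μ ∧ π.map Prod.snd = ν},
    (∫⁻ z, ENNReal.ofReal (dist z.1 z.2 ^ p) ∂π) ^ (1 / p)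

def Stiefel (d k : ℕ) : Set (Matrix (Fin d) (Fin k) ℝ) :=
  {E | E.transpose * E = 1}

noncomputable def proj {d k : ℕ} (E : Matrix (Fin d) (Fin k) ℝ)
    (x : EuclideanSpace ℝ (Fin d)) : EuclideanSpace ℝ (Fin k) :=
  (WithLp.equiv 2 (Fin k → ℝ)).symm (E.transpose.mulVec ((WithLp.equiv 2 (Fin d → ℝ)) x))

noncomputable def PRW (p : ℝ) {d : ℕ} (k : ℕ)
    (μ ν : Measure (EuclideanSpace ℝ (Fin d))) : ℝ≥0∞ :=
  ⨆ E ∈ Stiefel d k, Wp p (μ.map (proj E)) (ν.map (proj E))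

def WeakConv {α : Type*} [MeasurableSpace α] [TopologicalSpace α]
    (μs : ℕ → Measure α) (μ : Measure α) : Prop :=
  ∀ f : α →ᵇ ℝ, Tendsto (fun i => ∫ x, f x ∂(μs i)) atTop (𝓝 (∫ x, f x ∂μ))

noncomputable def empMeasure {α : Type*} [MeasurableSpace α] {n : ℕ} (X : Fin n → α) :
    Measure α :=
  (n : ℝ≥0∞)⁻¹ • ∑ i, Measure.dirac (X i)

instance matMeas {d k : ℕ} : MeasurableSpace (Matrix (Fin d) (Fin k) ℝ) :=
  MeasurableSpace.pi

noncomputable def IPRW (p : ℝ) {d k : ℕ} (σ : Measure (Matrix (Fin d) (Fin k) ℝ))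
    (μ ν : Measure (EuclideanSpace ℝ (Fin d))) : ℝ≥0∞ :=
  (∫⁻ E, Wp p (μ.map (proj E)) (ν.map (proj E)) ^ p ∂σ) ^ (1 / p)

noncomputable def projL {d k : ℕ} (E : Matrix (Fin d) (Fin k) ℝ) :
    EuclideanSpace ℝ (Fin d) →L[ℝ] EuclideanSpace ℝ (Fin k) :=
  LinearMap.toContinuousLinearMap (Matrix.toEuclideanLin E.transpose)

lemma Wp_le_of_tendsto {α : Type*} [MeasurableSpace α] [MetricSpace α] [CompleteSpace α]
    [SecondCountableTopology α] [BorelSpace α] {p : ℝ} (hp : 0 < p)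
    {P Q : ℕ → ProbabilityMeasure α} {P₀ Q₀ : ProbabilityMeasure α} {c : ℝ≥0∞}
    (hP : Tendsto P atTop (𝓝 P₀)) (hQ : Tendsto Q atTop (𝓝 Q₀))
    (hc : ∀ n, Wp p (P n : Measure α) (Q n) < c) :
    Wp p (P₀ : Measure α) Q₀ ≤ c := by
  have coupling : ∀ n, ∃ π : ProbabilityMeasure (α × α),
      (π : Measure (α × α)).map Prod.fst = P n ∧ (π : Measure (α × α)).map Prod.snd = Q n ∧
      (∫⁻ z, ENNReal.ofReal (dist z.1 z.2 ^ p) ∂(π : Measure (α × α))) ^ (1 / p) < c := by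
    intro n
    have h := hc n
    simp only [Wp, iInf_lt_iff] at h
    obtain ⟨π, ⟨h1, h2⟩, hlt⟩ := h
    have : IsProbabilityMeasure (π.map Prod.fst) := h1 ▸ inferInstance
    exact ⟨⟨π, Measure.isProbabilityMeasure_of_map Prod.fst⟩, h1, h2, hlt⟩
  choose π hπ₁ hπ₂ hπc using coupling
  have tight : ∀ {R : ℕ → ProbabilityMeasure α} {R₀ : ProbabilityMeasure α},
      Tendsto R atTop (𝓝 R₀) →
      IsTightMeasureSet {((μ : ProbabilityMeasure α) : Measure α) | μ ∈ Set.range R} := by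
    intro R R₀ hR
    refine (isTightMeasureSet_of_isCompact_closure (S := insert R₀ (Set.range R)) ?_).subset ?_
    · rw [hR.isCompact_insert_range.isClosed.closure_eq]
      exact hR.isCompact_insert_range
    · rintro _ ⟨μ, hμ, rfl⟩
      exact ⟨μ, Set.mem_insert_of_mem _ hμ, rfl⟩
  have tightπ : IsTightMeasureSet
      {((μ : ProbabilityMeasure (α × α)) : Measure (α × α)) | μ ∈ Set.range π} := by
    refine IsTightMeasureSet.prodMk ((tight hP).subset ?_) ((tight hQ).subset ?_)
    · rintro _ ⟨_, ⟨_, ⟨n, rfl⟩, rfl⟩, rfl⟩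
      exact ⟨P n, ⟨n, rfl⟩, (hπ₁ n).symm⟩
    · rintro _ ⟨_, ⟨_, ⟨n, rfl⟩, rfl⟩, rfl⟩
      exact ⟨Q n, ⟨n, rfl⟩, (hπ₂ n).symm⟩
  obtain ⟨π₀, -, φ, hφ, hlim⟩ :=
    (isCompact_closure_of_isTightMeasureSet tightπ).tendsto_subseq
      (fun n => subset_closure (Set.mem_range_self n))
  have marginal : ∀ {R : ℕ → ProbabilityMeasure α} {R₀ : ProbabilityMeasure α} {f : α × α → α},
      Continuous f → Tendsto R atTop (𝓝 R₀) →
      (∀ n, (π n : Measure (α × α)).map f = R n) → (π₀ : Measure (α × α)).map f = R₀ := by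
    intro R R₀ f hf hR h
    have h1 := ProbabilityMeasure.tendsto_map_of_tendsto_of_continuous _ _ hlim hf
    have h2 : Tendsto (fun n => ((π ∘ φ) n).map hf.measurable.aemeasurable) atTop (𝓝 R₀) := by
      convert! hR.comp hφ.tendsto_atTop using 2 with n
      exact Subtype.ext (h (φ n))
    exact congrArg ProbabilityMeasure.toMeasure (tendsto_nhds_unique h1 h2)
  have cost : ∫⁻ z, ENNReal.ofReal (dist z.1 z.2 ^ p) ∂(π₀ : Measure (α × α)) ≤ c ^ p := by
    refine (lintegral_le_liminf_lintegral_of_forall_isOpen_measure_le_liminf_measure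
      (μs := fun n => ((π ∘ φ) n : Measure (α × α)))
      (continuous_dist.rpow_const fun _ => Or.inr hp.le)
      (fun z => Real.rpow_nonneg dist_nonneg _)
      (fun G hG => ProbabilityMeasure.le_liminf_measure_open_of_tendsto hlim hG)).trans ?_
    refine (liminf_le_liminf (v := fun _ => c ^ p) (Eventually.of_forall fun n => ?_)).trans
      (liminf_const _).le
    have := (hπc (φ n)).le
    rwa [one_div, ENNReal.rpow_inv_le_iff hp] at this
  refine (iInf₂_le (π₀ : Measure (α × α))
    ⟨marginal continuous_fst hP hπ₁, marginal continuous_snd hQ hπ₂⟩).trans ?_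
  rwa [one_div, ENNReal.rpow_inv_le_iff hp]

lemma lowerSemicontinuous_Wp {α : Type*} [MeasurableSpace α] [MetricSpace α] [CompleteSpace α]
    [SecondCountableTopology α] [BorelSpace α] {p : ℝ} (hp : 0 < p) :
    LowerSemicontinuous fun x : ProbabilityMeasure α × ProbabilityMeasure α =>
      Wp p (x.1 : Measure α) x.2 := by
  rw [lowerSemicontinuous_iff_isClosed_preimage]
  refine fun c => IsSeqClosed.isClosed fun x x₀ hx hlim => ?_
  change Wp p (x₀.1 : Measure α) x₀.2 ≤ c
  refine le_of_forall_gt fun b hb => ?_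
  obtain ⟨b', hb', hb'b⟩ := exists_between hb
  exact (Wp_le_of_tendsto hp ((continuous_fst.tendsto _).comp hlim)
    ((continuous_snd.tendsto _).comp hlim) fun n => (hx n).trans_lt hb').trans_lt hb'b

lemma continuous_proj_uncurry {d k : ℕ} :
    Continuous fun z : Matrix (Fin d) (Fin k) ℝ × EuclideanSpace ℝ (Fin d) => proj z.1 z.2 := by
  refine (PiLp.continuous_toLp 2 _).comp ?_
  exact continuous_fst.matrix_transpose.matrix_mulVec
    ((PiLp.continuous_ofLp 2 _).comp continuous_snd)

lemma continuous_proj {d k : ℕ} (E : Matrix (Fin d) (Fin k) ℝ) : Continuous (proj E) :=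
  continuous_proj_uncurry.comp (Continuous.prodMk_right E)

lemma continuous_map_proj {d k : ℕ} (P : ProbabilityMeasure (EuclideanSpace ℝ (Fin d))) :
    Continuous fun E : Matrix (Fin d) (Fin k) ℝ =>
      P.map (continuous_proj E).measurable.aemeasurable := by
  rw [ProbabilityMeasure.continuous_iff_forall_continuous_integral]
  intro f
  simp only [ProbabilityMeasure.toMeasure_map]
  have : ∀ E : Matrix (Fin d) (Fin k) ℝ, ∫ y, f y ∂((P : Measure _).map (proj E)) =
      ∫ x, f (proj E x) ∂(P : Measure _) := fun E =>
    integral_map (continuous_proj E).measurable.aemeasurable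
      f.continuous.measurable.aestronglyMeasurable
  simp only [this]
  have : FirstCountableTopology (Matrix (Fin d) (Fin k) ℝ) :=
    inferInstanceAs (FirstCountableTopology (Fin d → Fin k → ℝ))
  refine continuous_of_dominated (bound := fun _ => ‖f‖) (fun E => ?_)
    (fun E => Eventually.of_forall fun x => f.norm_coe_le_norm _) (integrable_const _)
    (Eventually.of_forall fun x => ?_)
  · exact (f.continuous.comp (continuous_proj E)).measurable.aestronglyMeasurable
  · exact f.continuous.comp (continuous_proj_uncurry.comp (Continuous.prodMk_left x))

lemma measurable_Wp_map_proj {d k : ℕ} {p : ℝ} (hp : 0 < p)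
    (P Q : ProbabilityMeasure (EuclideanSpace ℝ (Fin d))) :
    Measurable fun E : Matrix (Fin d) (Fin k) ℝ =>
      Wp p ((P : Measure _).map (proj E)) ((Q : Measure _).map (proj E)) := by
  have : BorelSpace (Matrix (Fin d) (Fin k) ℝ) :=
    inferInstanceAs (BorelSpace (Fin d → Fin k → ℝ))
  exact ((lowerSemicontinuous_Wp hp).comp
    ((continuous_map_proj P).prodMk (continuous_map_proj Q))).measurable

lemma Wp_map_proj_le_liminf {d k : ℕ} {p : ℝ} (hp : 0 < p)
    {P Q : ℕ → ProbabilityMeasure (EuclideanSpace ℝ (Fin d))}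
    {P₀ Q₀ : ProbabilityMeasure (EuclideanSpace ℝ (Fin d))}
    (hP : Tendsto P atTop (𝓝 P₀)) (hQ : Tendsto Q atTop (𝓝 Q₀))
    (E : Matrix (Fin d) (Fin k) ℝ) :
    Wp p ((P₀ : Measure _).map (proj E)) ((Q₀ : Measure _).map (proj E)) ≤
      liminf (fun i => Wp p ((P i : Measure _).map (proj E)) ((Q i : Measure _).map (proj E)))
        atTop := by
  have hE := continuous_proj E
  have lim := (ProbabilityMeasure.tendsto_map_of_tendsto_of_continuous _ _ hP hE).prodMk_nhds
    (ProbabilityMeasure.tendsto_map_of_tendsto_of_continuous _ _ hQ hE)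
  exact ((lowerSemicontinuous_Wp hp).le_liminf _).trans (liminf_le_liminf_of_le lim)

lemma liminf_ennreal_rpow {p : ℝ} (hp : 0 ≤ p) (u : ℕ → ℝ≥0∞) :
    liminf u atTop ^ p = liminf (fun i => u i ^ p) atTop :=
  (ENNReal.monotone_rpow_of_nonneg hp).map_liminf_of_continuousAt u
    ENNReal.continuous_rpow_const.continuousAt

theorem stmt9 {d k : ℕ} (p : ℝ) (hp : 1 ≤ p)
    (σ : Measure (Matrix (Fin d) (Fin k) ℝ)) [IsProbabilityMeasure σ]
    (hσsupp : σ (Stiefel d k)ᶜ = 0)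
    (hσinv : ∀ Q : Matrix (Fin d) (Fin d) ℝ, Q ∈ Stiefel d d →
      σ.map (fun E => Q * E) = σ)
    (μs νs : ℕ → Measure (EuclideanSpace ℝ (Fin d)))
    (μ ν : Measure (EuclideanSpace ℝ (Fin d)))
    [∀ i, IsProbabilityMeasure (μs i)] [∀ i, IsProbabilityMeasure (νs i)]
    [IsProbabilityMeasure μ] [IsProbabilityMeasure ν]
    (hμ : WeakConv μs μ) (hν : WeakConv νs ν) :
    IPRW p σ μ ν ≤ liminf (fun i => IPRW p σ (μs i) (νs i)) atTop := by
  have hp0 : 0 < p := one_pos.trans_le hp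
  let P : ℕ → ProbabilityMeasure (EuclideanSpace ℝ (Fin d)) := fun i => ⟨μs i, inferInstance⟩
  let Q : ℕ → ProbabilityMeasure (EuclideanSpace ℝ (Fin d)) := fun i => ⟨νs i, inferInstance⟩
  have hP : Tendsto P atTop (𝓝 ⟨μ, inferInstance⟩) :=
    ProbabilityMeasure.tendsto_iff_forall_integral_tendsto.2 hμ
  have hQ : Tendsto Q atTop (𝓝 ⟨ν, inferInstance⟩) :=
    ProbabilityMeasure.tendsto_iff_forall_integral_tendsto.2 hν
  simp only [IPRW]
  rw [← liminf_ennreal_rpow (by positivity)]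
  refine ENNReal.rpow_le_rpow ?_ (by positivity)
  refine (lintegral_mono fun E => ?_).trans (lintegral_liminf_le fun i =>
    (measurable_Wp_map_proj hp0 (P i) (Q i)).pow_const p)
  rw [← liminf_ennreal_rpow hp0.le]
  exact ENNReal.rpow_le_rpow (Wp_map_proj_le_liminf hp0 hP hQ E) hp0.le
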